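/- arXiv:2208.08639 — 2 statements merged into one kernel-verified Lean document; each statement's English description precedes it below -/
import Mathlib

section
/- Let P_t, P_0, P_i, U_tip, v_0 > 0 and C ≥ 0 be constants, and let t > 0, δ ≥ 0. Suppose the slack variables satisfy x ≥ 0 with x² ≥ √(t⁴ + δ⁴/(4 v_0⁴)) − δ²/(2 v_0²), δ̄ > 0 with δ ≤ δ̄, and z, w ∈ ℝ with δ̄³/t² ≤ z²/δ̄ and z²/δ̄ ≤ w. Then the surrogate energy upper-bounds the true per-segment energy: P_t t + P_i x + P_0 ( t + 3δ²/(U_tip² t) ) + C w ≥ t·( P_t + P_0 (1 + 3δ²/(U_tip² t²)) + P_i (√(1 + δ⁴/(4 v_0⁴ t⁴)) − δ²/(2 v_0² t²))^{1/2} + C δ³/t³ ). -/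
/-- **Surrogate energy upper-bounds the true per-segment energy.** With constants
`P_t, P₀, P_ind, U_tip, v₀ > 0`, `C ≥ 0`, flight time `t > 0` and segment length `δ ≥ 0`,
if the slack variables satisfy `x ≥ 0`, `x² ≥ √(t⁴ + δ⁴/(4v₀⁴)) − δ²/(2v₀²)`,
`δ̄ > 0`, `δ ≤ δ̄`, `δ̄³/t² ≤ z²/δ̄` and `z²/δ̄ ≤ w`, then
`P_t t + P_ind x + P₀ (t + 3δ²/(U_tip² t)) + C w ≥ t (P_t + P_p(t))`, where `P_p(t)`
is the rotary-wing propulsion power. -/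
theorem surrogate_energy_upper_bound
    (Pt P0 Pind Utip v0 C : ℝ)
    (hPt : 0 < Pt) (hP0 : 0 < P0) (hPind : 0 < Pind) (hUtip : 0 < Utip) (hv0 : 0 < v0)
    (hC : 0 ≤ C)
    (t δ : ℝ) (ht : 0 < t) (hδ : 0 ≤ δ)
    (x : ℝ) (hx : 0 ≤ x)
    (hx2 : Real.sqrt (t ^ 4 + δ ^ 4 / (4 * v0 ^ 4)) - δ ^ 2 / (2 * v0 ^ 2) ≤ x ^ 2)
    (δb : ℝ) (hδb : 0 < δb) (hδδb : δ ≤ δb)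
    (z w : ℝ) (hz : δb ^ 3 / t ^ 2 ≤ z ^ 2 / δb) (hw : z ^ 2 / δb ≤ w) :
    t * (Pt + P0 * (1 + 3 * δ ^ 2 / (Utip ^ 2 * t ^ 2))
        + Pind * Real.sqrt (Real.sqrt (1 + δ ^ 4 / (4 * v0 ^ 4 * t ^ 4))
            - δ ^ 2 / (2 * v0 ^ 2 * t ^ 2))
        + C * δ ^ 3 / t ^ 3) ≤
      Pt * t + Pind * x + P0 * (t + 3 * δ ^ 2 / (Utip ^ 2 * t)) + C * w := by
  have hsqrt : t ^ 2 * Real.sqrt (1 + δ ^ 4 / (4 * v0 ^ 4 * t ^ 4)) =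
      Real.sqrt (t ^ 4 + δ ^ 4 / (4 * v0 ^ 4)) := by
    have h : t ^ 4 + δ ^ 4 / (4 * v0 ^ 4) =
        (t ^ 2) ^ 2 * (1 + δ ^ 4 / (4 * v0 ^ 4 * t ^ 4)) := by
      field_simp
    rw [h, Real.sqrt_mul (by positivity), Real.sqrt_sq (by positivity)]
  have hinduced : t * Real.sqrt (Real.sqrt (1 + δ ^ 4 / (4 * v0 ^ 4 * t ^ 4))
      - δ ^ 2 / (2 * v0 ^ 2 * t ^ 2)) ≤ x := by
    rw [mul_comm, ← le_div_iff₀ ht]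
    apply Real.sqrt_le_iff.mpr
    refine ⟨by positivity, ?_⟩
    rw [div_pow, le_div_iff₀ (by positivity), sub_mul, mul_comm, hsqrt]
    have hv : δ ^ 2 / (2 * v0 ^ 2 * t ^ 2) * t ^ 2 = δ ^ 2 / (2 * v0 ^ 2) := by
      field_simp
    rwa [hv]
  have hparasite : δ ^ 3 / t ^ 2 ≤ w :=
    (div_le_div_of_nonneg_right (pow_le_pow_left₀ hδ hδδb 3) (by positivity)).trans
      (hz.trans hw)
  have hind := mul_le_mul_of_nonneg_left hinduced hPind.le
  have hpar := mul_le_mul_of_nonneg_left hparasite hC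
  have hblade : t * (P0 * (1 + 3 * δ ^ 2 / (Utip ^ 2 * t ^ 2))) =
      P0 * (t + 3 * δ ^ 2 / (Utip ^ 2 * t)) := by
    field_simp
  have hdrag : t * (C * δ ^ 3 / t ^ 3) = C * (δ ^ 3 / t ^ 2) := by
    field_simp
  rw [mul_add, mul_add, mul_add, hblade, hdrag]
  linarith
end

section
/- In the setting of the smoothed minimum of Hermitian quadratics, for every φ^r, d ∈ ℂ^N the map j(γ) = f(φ^r + γ d) is twice differentiable with j''(γ) = Σ_k g̃_k(γ)·( 2 Re{d^H B_k d} − μ (h̃_k'(γ))² ) + μ ( Σ_k g̃_k(γ) h̃_k'(γ) )², where h̃_k(γ) = h_k(φ^r + γ d), h̃_k'(γ) = 2 Re{ (B_k(φ^r + γ d) + b_k)^H d }, and g̃_k(γ) = exp(−μ h̃_k(γ)) / Σ_j exp(−μ h̃_j(γ)). -/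
open Matrix

noncomputable section

/-- The Hermitian quadratic `h(φ) = φᴴ B φ + 2 Re{bᴴ φ} + c` (real-valued since `B` is
Hermitian; we take the real part). -/
def hquad {N : ℕ} (B : Matrix (Fin N) (Fin N) ℂ) (b : Fin N → ℂ) (c : ℝ)
    (φ : Fin N → ℂ) : ℝ :=
  (star φ ⬝ᵥ (B *ᵥ φ)).re + 2 * (star b ⬝ᵥ φ).re + c

/-- The smoothed minimum `f(φ) = −(1/μ) log ∑ k exp(−μ h_k(φ))`. -/
def fsm {N K : ℕ} (μ : ℝ) (B : Fin K → Matrix (Fin N) (Fin N) ℂ)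
    (b : Fin K → Fin N → ℂ) (c : Fin K → ℝ) (φ : Fin N → ℂ) : ℝ :=
  -(1 / μ) * Real.log (∑ k, Real.exp (-μ * hquad (B k) (b k) (c k) φ))

/-- The softmin weights `g_k(φ) = exp(−μ h_k(φ)) / ∑ j exp(−μ h_j(φ))`. -/
def gwt {N K : ℕ} (μ : ℝ) (B : Fin K → Matrix (Fin N) (Fin N) ℂ)
    (b : Fin K → Fin N → ℂ) (c : Fin K → ℝ) (k : Fin K) (φ : Fin N → ℂ) : ℝ :=
  Real.exp (-μ * hquad (B k) (b k) (c k) φ) /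
    ∑ j, Real.exp (-μ * hquad (B j) (b j) (c j) φ)

/-- `h̃_k'(γ) = 2 Re{(B_k(φʳ + γ d) + b_k)ᴴ d}`, the derivative of
`γ ↦ h_k(φʳ + γ d)`. -/
def htilde' {N K : ℕ} (B : Fin K → Matrix (Fin N) (Fin N) ℂ)
    (b : Fin K → Fin N → ℂ) (φr d : Fin N → ℂ) (k : Fin K) (γ : ℝ) : ℝ :=
  2 * (star (B k *ᵥ (φr + γ • d) + b k) ⬝ᵥ d).re

/-- `dᴴ B e` and `eᴴ B d` have the same real part for Hermitian `B`. -/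
theorem re_star_dotProduct_mulVec_comm {N : ℕ} {B : Matrix (Fin N) (Fin N) ℂ}
    (hB : B.IsHermitian) (d e : Fin N → ℂ) :
    (star d ⬝ᵥ (B *ᵥ e)).re = (star e ⬝ᵥ (B *ᵥ d)).re := by
  have h : star (star d ⬝ᵥ (B *ᵥ e)) = star e ⬝ᵥ (B *ᵥ d) := by
    rw [star_dotProduct, star_star, star_mulVec, hB.eq, ← dotProduct_mulVec]
  rw [← h]
  simp

theorem re_star_mulVec_dotProduct {N : ℕ} {B : Matrix (Fin N) (Fin N) ℂ}
    (hB : B.IsHermitian) (d e : Fin N → ℂ) :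
    (star (B *ᵥ d) ⬝ᵥ e).re = (star d ⬝ᵥ (B *ᵥ e)).re := by
  rw [star_mulVec, hB.eq, ← dotProduct_mulVec]

theorem htilde'_eq_affine {N K : ℕ} {B : Fin K → Matrix (Fin N) (Fin N) ℂ}
    (hB : ∀ k, (B k).IsHermitian) (b : Fin K → Fin N → ℂ) (φr d : Fin N → ℂ)
    (k : Fin K) (γ : ℝ) :
    htilde' B b φr d k γ =
      2 * ((star φr ⬝ᵥ (B k *ᵥ d)).re + (star (b k) ⬝ᵥ d).re) +
        γ * (2 * (star d ⬝ᵥ (B k *ᵥ d)).re) := by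
  simp only [htilde', mulVec_add, mulVec_smul, star_add, star_smul, add_dotProduct,
    smul_dotProduct, Complex.add_re, Complex.real_smul, star_trivial, Complex.re_ofReal_mul,
    re_star_mulVec_dotProduct (hB k)]
  ring

theorem hquad_line_eq {N : ℕ} {B : Matrix (Fin N) (Fin N) ℂ}
    (hB : B.IsHermitian) (b : Fin N → ℂ) (c : ℝ) (φr d : Fin N → ℂ) (γ : ℝ) :
    hquad B b c (φr + γ • d) =
      hquad B b c φr + γ * (2 * ((star φr ⬝ᵥ (B *ᵥ d)).re + (star b ⬝ᵥ d).re)) +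
        γ ^ 2 * (star d ⬝ᵥ (B *ᵥ d)).re := by
  simp only [hquad, mulVec_add, mulVec_smul, star_add, star_smul, add_dotProduct,
    dotProduct_add, dotProduct_smul, smul_dotProduct, Complex.add_re, Complex.real_smul,
    star_trivial, Complex.re_ofReal_mul, re_star_dotProduct_mulVec_comm hB d φr]
  ring

theorem hasDerivAt_htilde' {N K : ℕ} {B : Fin K → Matrix (Fin N) (Fin N) ℂ}
    (hB : ∀ k, (B k).IsHermitian) (b : Fin K → Fin N → ℂ) (φr d : Fin N → ℂ)
    (k : Fin K) (γ : ℝ) :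
    HasDerivAt (htilde' B b φr d k) (2 * (star d ⬝ᵥ (B k *ᵥ d)).re) γ := by
  rw [funext (htilde'_eq_affine hB b φr d k)]
  simpa using ((hasDerivAt_id γ).mul_const (2 * (star d ⬝ᵥ (B k *ᵥ d)).re)).const_add
    (2 * ((star φr ⬝ᵥ (B k *ᵥ d)).re + (star (b k) ⬝ᵥ d).re))

theorem hasDerivAt_hquad_line {N K : ℕ} {B : Fin K → Matrix (Fin N) (Fin N) ℂ}
    (hB : ∀ k, (B k).IsHermitian) (b : Fin K → Fin N → ℂ) (c : Fin K → ℝ)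
    (φr d : Fin N → ℂ) (k : Fin K) (γ : ℝ) :
    HasDerivAt (fun γ : ℝ => hquad (B k) (b k) (c k) (φr + γ • d))
      (htilde' B b φr d k γ) γ := by
  rw [htilde'_eq_affine hB, funext (hquad_line_eq (hB k) (b k) (c k) φr d)]
  refine ((((hasDerivAt_id γ).mul_const _).const_add _).add
    ((hasDerivAt_pow 2 γ).mul_const _)).congr_deriv ?_
  simp
  ring

theorem hasDerivAt_exp_neg_mul {h : ℝ → ℝ} {h' γ : ℝ} (μ : ℝ) (hh : HasDerivAt h h' γ) :
    HasDerivAt (fun x => Real.exp (-μ * h x)) (-μ * (Real.exp (-μ * h γ) * h')) γ :=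
  (hh.const_mul (-μ)).exp.congr_deriv (by ring)

theorem hasDerivAt_sum_exp_neg_mul {ι : Type*} [Fintype ι] {h : ι → ℝ → ℝ} {h' : ι → ℝ}
    {γ : ℝ} (μ : ℝ) (hh : ∀ k, HasDerivAt (h k) (h' k) γ) :
    HasDerivAt (fun x => ∑ k, Real.exp (-μ * h k x))
      (-μ * ∑ k, Real.exp (-μ * h k γ) * h' k) γ := by
  rw [Finset.mul_sum]
  exact HasDerivAt.fun_sum fun k _ => hasDerivAt_exp_neg_mul μ (hh k)

/-- The derivative of a smoothed minimum is the softmin average of the derivatives. -/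
theorem hasDerivAt_neg_log_sum_exp {ι : Type*} [Fintype ι] [Nonempty ι] {h : ι → ℝ → ℝ}
    {h' : ι → ℝ} {γ μ : ℝ} (hμ : μ ≠ 0) (hh : ∀ k, HasDerivAt (h k) (h' k) γ) :
    HasDerivAt (fun x => -(1 / μ) * Real.log (∑ k, Real.exp (-μ * h k x)))
      (∑ k, Real.exp (-μ * h k γ) / (∑ j, Real.exp (-μ * h j γ)) * h' k) γ := by
  have hS : (∑ k, Real.exp (-μ * h k γ)) ≠ 0 :=
    (Finset.sum_pos (fun k _ => Real.exp_pos _) Finset.univ_nonempty).ne'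
  refine (((hasDerivAt_sum_exp_neg_mul μ hh).log hS).const_mul (-(1 / μ))).congr_deriv ?_
  simp only [div_mul_eq_mul_div, ← Finset.sum_div]
  field_simp

/-- The derivative of a softmin average of functions `u k`, in the case where the exponents
have derivatives `u k`. -/
theorem hasDerivAt_softmin_average {ι : Type*} [Fintype ι] [Nonempty ι] {h u : ι → ℝ → ℝ}
    {u' : ι → ℝ} {γ : ℝ} (μ : ℝ) (hh : ∀ k, HasDerivAt (h k) (u k γ) γ)
    (hu : ∀ k, HasDerivAt (u k) (u' k) γ) :
    HasDerivAt (fun x => ∑ k, Real.exp (-μ * h k x) / (∑ j, Real.exp (-μ * h j x)) * u k x)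
      ((∑ k, Real.exp (-μ * h k γ) / (∑ j, Real.exp (-μ * h j γ)) *
          (u' k - μ * u k γ ^ 2)) +
        μ * (∑ k, Real.exp (-μ * h k γ) / (∑ j, Real.exp (-μ * h j γ)) * u k γ) ^ 2) γ := by
  have hS : (∑ k, Real.exp (-μ * h k γ)) ≠ 0 :=
    (Finset.sum_pos (fun k _ => Real.exp_pos _) Finset.univ_nonempty).ne'
  simp only [div_mul_eq_mul_div, ← Finset.sum_div]
  have hnum : HasDerivAt (fun x => ∑ k, Real.exp (-μ * h k x) * u k x)
      (∑ k, Real.exp (-μ * h k γ) * (u' k - μ * u k γ ^ 2)) γ :=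
    HasDerivAt.fun_sum fun k _ =>
      ((hasDerivAt_exp_neg_mul μ (hh k)).mul (hu k)).congr_deriv (by ring)
  refine (hnum.div (hasDerivAt_sum_exp_neg_mul μ hh) hS).congr_deriv ?_
  field_simp
  ring

/-- **Second derivative of the smoothed minimum along a line.** `j(γ) = f(φʳ + γ d)` is
twice differentiable, with `j'(γ) = ∑ k g̃_k(γ) h̃_k'(γ)` and
`j''(γ) = ∑ k g̃_k(γ)(2 Re{dᴴ B_k d} − μ h̃_k'(γ)²) + μ (∑ k g̃_k(γ) h̃_k'(γ))²`. -/
theorem smoothed_min_second_derivative (N K : ℕ) (hN : 1 ≤ N) (hK : 1 ≤ K)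
    (μ : ℝ) (hμ : 0 < μ)
    (B : Fin K → Matrix (Fin N) (Fin N) ℂ) (hBherm : ∀ k, (B k).IsHermitian)
    (b : Fin K → Fin N → ℂ) (c : Fin K → ℝ) (φr d : Fin N → ℂ) :
    ∀ γ : ℝ,
      HasDerivAt (fun γ : ℝ => fsm μ B b c (φr + γ • d))
        (∑ k, gwt μ B b c k (φr + γ • d) * htilde' B b φr d k γ) γ ∧
      HasDerivAt (fun γ : ℝ => ∑ k, gwt μ B b c k (φr + γ • d) * htilde' B b φr d k γ)
        ((∑ k, gwt μ B b c k (φr + γ • d) *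
            (2 * (star d ⬝ᵥ (B k *ᵥ d)).re - μ * htilde' B b φr d k γ ^ 2))
          + μ * (∑ k, gwt μ B b c k (φr + γ • d) * htilde' B b φr d k γ) ^ 2) γ := by
  intro γ
  have : Nonempty (Fin K) := Fin.pos_iff_nonempty.mp hK
  have hh := fun k => hasDerivAt_hquad_line hBherm b c φr d k γ
  exact ⟨hasDerivAt_neg_log_sum_exp hμ.ne' hh,
    hasDerivAt_softmin_average μ hh fun k => hasDerivAt_htilde' hBherm b φr d k γ⟩

end
end
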